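/- In base b = 2, for every x ∈ [0,1) the following exact formula holds: ω_3(x) = (1 − 2x) + (1/3 − 2(1−x)x) + (1 − 43t_2)/18 + (5t_1 − 1)x − (2 − a_1)x², where for 0 < x < 1, a_1 = −⌊log_2 x⌋, t_1 = 2^{−a_1} and t_2 = 2^{−2a_1}, and for x = 0, a_1 = 0, t_1 = 0 and t_2 = 0 (so that ω_3(0) = 25/18). -/

import Mathlib

open scoped BigOperators
open scoped Classical

noncomputable section

/-- The `i`-th base-`b` digit (for `i ≥ 1`) of a real `x` (intended `x ∈ [0,1)`),
using the expansion that does not end in infinitely many digits `b-1`. -/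
def xdigit (b : ℕ) (x : ℝ) (i : ℕ) : ℕ := (⌊x * (b : ℝ) ^ i⌋).toNat % b

/-- The `i`-th base-`b` digit of a natural number `k`. -/
def ndigit (b k i : ℕ) : ℕ := k / b ^ i % b

/-- The `k`-th Walsh function in base `b`:
`wal_k(x) = exp(2πi (ξ_1 κ_0 + ξ_2 κ_1 + ⋯)/b)`. -/
def wal (b k : ℕ) (x : ℝ) : ℂ :=
  Complex.exp (2 * (Real.pi : ℂ) * Complex.I / (b : ℂ) *
    ∑ i ∈ Finset.range (k + 1), (ndigit b k i : ℂ) * (xdigit b x (i + 1) : ℂ))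

/-- The set of positions of nonzero base-`b` digits of `k`. -/
def nzset (b k : ℕ) : Finset ℕ :=
  (Finset.range (k + 1)).filter fun i => ndigit b k i ≠ 0

/-- The (at most) `α` largest nonzero-digit positions of `k` in base `b`. -/
def topPos (b α k : ℕ) : Finset ℕ :=
  (nzset b k).filter fun a => ((nzset b k).filter fun y => a < y).card < α

/-- `r_α(k) = b^{-∑_{i=1}^{min(#k,α)} (a_i + 1)}`, where `a_1 > a_2 > ⋯` are the positions of
the nonzero base-`b` digits of `k`; `r_α(0) = 1`. -/
def ralpha (b α k : ℕ) : ℝ := ((b : ℝ) ^ (∑ a ∈ topPos b α k, (a + 1)))⁻¹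

/-- `r_α(γ, k) = ∏_{j : k_j ≠ 0} γ_j r_α(k_j)` (weights indexed from `0`). -/
def rvec (b α : ℕ) (γ : ℕ → ℝ) {s : ℕ} (k : Fin s → ℕ) : ℝ :=
  ∏ j, if k j = 0 then 1 else γ (j : ℕ) * ralpha b α (k j)

/-- `ω_α(x) = ∑_{k=1}^∞ r_α(k) wal_k(x)`. -/
def omegaF (b α : ℕ) (x : ℝ) : ℂ :=
  ∑' k : ℕ, (ralpha b α (k + 1) : ℂ) * wal b (k + 1) x

/-- `a_1 = -⌊log_2 x⌋` for `0 < x < 1`, and `a_1 = 0` for `x = 0`. -/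
def a1Int (x : ℝ) : ℤ := if x = 0 then 0 else -⌊Real.logb 2 x⌋

/-- `t_1 = 2^{-a_1}` for `0 < x < 1`, and `t_1 = 0` for `x = 0`. -/
def t1R (x : ℝ) : ℝ := if x = 0 then 0 else (2 : ℝ) ^ (-(a1Int x))

/-- `t_2 = 2^{-2a_1}` for `0 < x < 1`, and `t_2 = 0` for `x = 0`. -/
def t2R (x : ℝ) : ℝ := if x = 0 then 0 else (2 : ℝ) ^ (-(2 * a1Int x))

lemma mem_nzset_two {k i : ℕ} : i ∈ nzset 2 k ↔ k.testBit i = true := by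
  have h : ndigit 2 k i ≠ 0 ↔ k.testBit i = true := by
    rw [ndigit, Nat.testBit_eq_decide_div_mod_eq, decide_eq_true_eq]
    omega
  rw [nzset, Finset.mem_filter, h, Finset.mem_range, and_iff_right_iff_imp]
  intro hi
  have := Nat.ge_two_pow_of_testBit hi
  have := i.lt_two_pow_self
  omega

lemma lt_of_mem_nzset_two {n k i : ℕ} (hk : k < 2 ^ n) (hi : i ∈ nzset 2 k) : i < n :=
  (Nat.pow_lt_pow_iff_right one_lt_two).1
    ((Nat.ge_two_pow_of_testBit (mem_nzset_two.1 hi)).trans_lt hk)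

lemma nzset_two_pow_add {n k : ℕ} (hk : k < 2 ^ n) :
    nzset 2 (2 ^ n + k) = insert n (nzset 2 k) := by
  ext i
  rw [Finset.mem_insert, mem_nzset_two, mem_nzset_two]
  rcases lt_trichotomy i n with h | rfl | h
  · rw [Nat.testBit_two_pow_add_gt h]
    simp [h.ne]
  · simp [Nat.testBit_two_pow_add_eq, Nat.testBit_lt_two_pow hk]
  · have hlt : 2 ^ n + k < 2 ^ i :=
      calc 2 ^ n + k < 2 ^ (n + 1) := by rw [pow_succ]; omega
        _ ≤ 2 ^ i := Nat.pow_le_pow_right two_pos h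
    have hk' : k < 2 ^ i := by omega
    simp [Nat.testBit_lt_two_pow hlt, Nat.testBit_lt_two_pow hk', h.ne']

lemma notMem_nzset_two {n k : ℕ} (hk : k < 2 ^ n) : n ∉ nzset 2 k :=
  fun h => (lt_of_mem_nzset_two hk h).false

lemma topPos_two_pow_add {n k : ℕ} (hk : k < 2 ^ n) (j : ℕ) :
    topPos 2 (j + 1) (2 ^ n + k) = insert n (topPos 2 j k) := by
  have hlt : ∀ i ∈ nzset 2 k, i < n := fun i hi => lt_of_mem_nzset_two hk hi
  ext a
  simp only [topPos, nzset_two_pow_add hk, Finset.mem_filter, Finset.mem_insert]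
  by_cases ha : a = n
  · subst ha
    have : (insert a (nzset 2 k)).filter (fun y => a < y) = ∅ := by
      ext y
      simp only [Finset.mem_filter, Finset.mem_insert, Finset.notMem_empty, iff_false, not_and,
        not_lt]
      rintro (rfl | hy)
      · exact le_rfl
      · exact (hlt y hy).le
    simp [this]
  · simp only [ha, false_or]
    refine and_congr_right fun haS => ?_
    rw [Finset.filter_insert, if_pos (hlt a haS), Finset.card_insert_of_notMem]
    · omega
    · exact fun h => notMem_nzset_two hk (Finset.mem_filter.1 h).1

lemma ralpha_two_pow_add {n k : ℕ} (hk : k < 2 ^ n) (j : ℕ) :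
    ralpha 2 (j + 1) (2 ^ n + k) = (1 / 2) ^ (n + 1) * ralpha 2 j k := by
  have hn : n ∉ topPos 2 j k := fun h => notMem_nzset_two hk (Finset.mem_filter.1 h).1
  rw [ralpha, ralpha, topPos_two_pow_add hk, Finset.sum_insert hn, pow_add, mul_inv]
  simp

lemma ralpha_zero_left (k : ℕ) : ralpha 2 0 k = 1 := by simp [ralpha, topPos]

lemma ralpha_zero_right (j : ℕ) : ralpha 2 j 0 = 1 := by simp [ralpha, topPos, nzset, ndigit]

lemma ralpha_nonneg (j k : ℕ) : 0 ≤ ralpha 2 j k := by unfold ralpha; positivity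

/-- The partial sum over `k < 2 ^ n` of `r_j(k)` times the product of the signs `ε i` over the
nonzero digit positions `i` of `k`. -/
def signedSum (ε : ℕ → ℝ) (j n : ℕ) : ℝ :=
  ∑ k ∈ Finset.range (2 ^ n), ralpha 2 j k * ∏ i ∈ nzset 2 k, ε i

lemma signedSum_zero (ε : ℕ → ℝ) (j : ℕ) : signedSum ε j 0 = 1 := by
  simp [signedSum, ralpha_zero_right, nzset, ndigit]

lemma prod_nzset_two_pow_add (ε : ℕ → ℝ) {n k : ℕ} (hk : k < 2 ^ n) :
    ∏ i ∈ nzset 2 (2 ^ n + k), ε i = ε n * ∏ i ∈ nzset 2 k, ε i := by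
  rw [nzset_two_pow_add hk, Finset.prod_insert (notMem_nzset_two hk)]

lemma signedSum_zero_succ (ε : ℕ → ℝ) (n : ℕ) :
    signedSum ε 0 (n + 1) = (1 + ε n) * signedSum ε 0 n := by
  rw [signedSum, pow_succ, mul_two, Finset.sum_range_add, add_mul, one_mul, signedSum,
    Finset.mul_sum]
  congr 1
  refine Finset.sum_congr rfl fun k hk => ?_
  rw [prod_nzset_two_pow_add ε (Finset.mem_range.1 hk), ralpha_zero_left, ralpha_zero_left]
  ring

lemma signedSum_succ_succ (ε : ℕ → ℝ) (j n : ℕ) :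
    signedSum ε (j + 1) (n + 1) =
      signedSum ε (j + 1) n + (1 / 2) ^ (n + 1) * ε n * signedSum ε j n := by
  rw [signedSum, pow_succ, mul_two, Finset.sum_range_add, signedSum, signedSum, Finset.mul_sum]
  congr 1
  refine Finset.sum_congr rfl fun k hk => ?_
  rw [prod_nzset_two_pow_add ε (Finset.mem_range.1 hk), ralpha_two_pow_add (Finset.mem_range.1 hk)]
  ring

lemma signedSum_of_eq_one {ε : ℕ → ℝ} {n : ℕ} (h : ∀ m < n, ε m = 1) :
    signedSum ε 0 n = 2 ^ n ∧ signedSum ε 1 n = 1 + n / 2 ∧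
      signedSum ε 2 n = 5 / 2 - (n + 3) / 2 * (1 / 2) ^ n ∧
      signedSum ε 3 n =
        43 / 18 - 5 / 2 * (1 / 2) ^ n + (n / 3 + 10 / 9) * ((1 / 2) ^ n) ^ 2 := by
  induction n with
  | zero => simp only [signedSum_zero]; norm_num
  | succ n ih =>
    obtain ⟨h0, h1, h2, h3⟩ := ih fun m hm => h m (hm.trans n.lt_succ_self)
    have hp : (1 / 2 : ℝ) ^ n * 2 ^ n = 1 := by rw [← mul_pow]; norm_num
    rw [signedSum_zero_succ, signedSum_succ_succ, signedSum_succ_succ, signedSum_succ_succ,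
      h0, h1, h2, h3, h n n.lt_succ_self]
    push_cast
    refine ⟨by ring, ?_, by ring, by ring⟩
    linear_combination (1 / 2) * hp

lemma summable_ralpha_three : Summable (ralpha 2 3) := by
  refine summable_of_sum_range_le (c := 4) (ralpha_nonneg 3) fun n => ?_
  calc ∑ k ∈ Finset.range n, ralpha 2 3 k
      ≤ ∑ k ∈ Finset.range (2 ^ n), ralpha 2 3 k :=
        Finset.sum_le_sum_of_subset_of_nonneg (Finset.range_mono n.lt_two_pow_self.le)
          fun k _ _ => ralpha_nonneg 3 k
    _ = signedSum (fun _ => 1) 3 n := by simp [signedSum]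
    _ ≤ 4 := by
      rw [(signedSum_of_eq_one fun _ _ => rfl).2.2.2]
      have hq : (0 : ℝ) < (1 / 2) ^ n := by positivity
      have hq1 : (1 / 2 : ℝ) ^ n ≤ 1 := pow_le_one₀ (by norm_num) (by norm_num)
      have hn : (n : ℝ) * (1 / 2) ^ n ≤ 1 := by
        rw [one_div, inv_pow, ← div_eq_mul_inv, div_le_one (by positivity)]
        exact_mod_cast n.lt_two_pow_self.le
      nlinarith

/-- The sign `(-1) ^ ξ_{i+1}` of the binary digit `ξ_{i+1}` of `x`. -/
def digitSign (x : ℝ) (i : ℕ) : ℝ := (-1) ^ xdigit 2 x (i + 1)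

lemma wal_two_eq_prod (k : ℕ) (x : ℝ) :
    wal 2 k x = ((∏ i ∈ nzset 2 k, digitSign x i : ℝ) : ℂ) := by
  have hs : ∑ i ∈ Finset.range (k + 1), (ndigit 2 k i : ℂ) * (xdigit 2 x (i + 1) : ℂ) =
      ((∑ i ∈ nzset 2 k, xdigit 2 x (i + 1) : ℕ) : ℂ) := by
    rw [nzset, Finset.sum_filter, Nat.cast_sum]
    refine Finset.sum_congr rfl fun i _ => ?_
    rcases Nat.mod_two_eq_zero_or_one (k / 2 ^ i) with h | h <;> simp [ndigit, h]
  have he : 2 * (Real.pi : ℂ) * Complex.I / ((2 : ℕ) : ℂ) = Real.pi * Complex.I := by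
    push_cast; ring
  rw [wal, hs, he, mul_comm, Complex.exp_nat_mul, Complex.exp_pi_mul_I]
  simp only [digitSign]
  rw [Finset.prod_pow_eq_pow_sum]
  push_cast
  rfl

lemma abs_digitSign (x : ℝ) (i : ℕ) : |digitSign x i| = 1 := by simp [digitSign]

lemma omegaF_two_three_eq_of_tendsto {x L : ℝ}
    (h : Filter.Tendsto (signedSum (digitSign x) 3) Filter.atTop (nhds L)) :
    omegaF 2 3 x = ((L - 1 : ℝ) : ℂ) := by
  set f : ℕ → ℝ := fun k => ralpha 2 3 k * ∏ i ∈ nzset 2 k, digitSign x i with hf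
  have hsum : Summable f := by
    refine Summable.of_norm (summable_ralpha_three.congr fun k => ?_)
    simp [hf, abs_digitSign, abs_of_nonneg (ralpha_nonneg 3 k)]
  have hL : ∑' k, f k = L :=
    tendsto_nhds_unique
      (hsum.hasSum.tendsto_sum_nat.comp (tendsto_pow_atTop_atTop_of_one_lt one_lt_two)) h
  have h0 : f 0 = 1 := by simp [hf, ralpha_zero_right, nzset, ndigit]
  have h1 := hsum.tsum_eq_zero_add
  rw [hL, h0] at h1
  rw [omegaF, h1, add_sub_cancel_left, Complex.ofReal_tsum]
  refine tsum_congr fun k => ?_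
  rw [wal_two_eq_prod, ← Complex.ofReal_mul]

/-- The tail `∑_{m ≥ n} (-1) ^ ξ_{m+1} 2 ^ (-(m+1))` of the signed binary expansion of `x`. -/
def signTail (x : ℝ) (n : ℕ) : ℝ := (1 / 2) ^ n * (1 - 2 * Int.fract (x * 2 ^ n))

lemma signTail_sub_succ {x : ℝ} (hx : 0 ≤ x) (n : ℕ) :
    signTail x n - signTail x (n + 1) = (1 / 2) ^ (n + 1) * digitSign x n := by
  have key : 1 - 4 * Int.fract (x * 2 ^ n) + 2 * Int.fract (x * 2 ^ (n + 1)) =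
      digitSign x n := by
    have hfl := Int.floor_add_fract (x * 2 ^ n)
    have h0 := Int.fract_nonneg (x * 2 ^ n)
    have h1 := Int.fract_lt_one (x * 2 ^ n)
    have hm : 0 ≤ ⌊x * 2 ^ n⌋ := Int.floor_nonneg.2 (by positivity)
    obtain ⟨m, hm⟩ := Int.eq_ofNat_of_zero_le hm
    rw [hm] at hfl
    push_cast at hfl
    simp only [digitSign, xdigit, Nat.cast_ofNat]
    rw [← Int.self_sub_floor (x * 2 ^ (n + 1))]
    rcases lt_or_ge (Int.fract (x * 2 ^ n)) (1 / 2) with h | h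
    · have : ⌊x * 2 ^ (n + 1)⌋ = ((2 * m : ℕ) : ℤ) := by
        rw [Int.floor_eq_iff]
        push_cast
        constructor <;> rw [pow_succ] <;> linarith
      rw [this, Int.toNat_natCast, Nat.mul_mod_right]
      push_cast
      rw [pow_succ]
      linarith
    · have : ⌊x * 2 ^ (n + 1)⌋ = ((2 * m + 1 : ℕ) : ℤ) := by
        rw [Int.floor_eq_iff]
        push_cast
        constructor <;> rw [pow_succ] <;> linarith
      rw [this, Int.toNat_natCast, Nat.mul_add_mod]
      push_cast
      norm_num
      rw [pow_succ]
      linarith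
  rw [← key, signTail, signTail]
  ring

lemma tendsto_half_pow : Filter.Tendsto (fun n : ℕ => (1 / 2 : ℝ) ^ n) Filter.atTop (nhds 0) :=
  tendsto_pow_atTop_nhds_zero_of_lt_one (by norm_num) (by norm_num)

lemma tendsto_signTail (x : ℝ) : Filter.Tendsto (signTail x) Filter.atTop (nhds 0) := by
  refine squeeze_zero_norm (fun n => ?_) tendsto_half_pow
  have h0 := Int.fract_nonneg (x * 2 ^ n)
  have h1 := Int.fract_lt_one (x * 2 ^ n)
  rw [signTail, norm_mul, Real.norm_of_nonneg (by positivity)]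
  refine mul_le_of_le_one_right (by positivity) ?_
  rw [Real.norm_eq_abs, abs_le]
  constructor <;> linarith

lemma digitSign_eq_one {x : ℝ} (hx : 0 ≤ x) {m : ℕ} (h : x * 2 ^ (m + 1) < 1) :
    digitSign x m = 1 := by
  have : ⌊x * 2 ^ (m + 1)⌋ = 0 := Int.floor_eq_zero_iff.2 ⟨by positivity, h⟩
  simp [digitSign, xdigit, this]

lemma digitSign_eq_neg_one {x : ℝ} {m : ℕ} (h1 : 1 ≤ x * 2 ^ (m + 1)) (h2 : x * 2 ^ (m + 1) < 2) :
    digitSign x m = -1 := by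
  have : ⌊x * 2 ^ (m + 1)⌋ = 1 := by
    rw [Int.floor_eq_iff]
    constructor <;> push_cast <;> linarith
  simp [digitSign, xdigit, this]

lemma signedSum_of_first_digit {x : ℝ} (hx : 0 ≤ x) {c : ℕ} (h1 : 1 ≤ x * 2 ^ (c + 1))
    (h2 : x * 2 ^ (c + 1) < 2) (d : ℕ) :
    signedSum (digitSign x) 0 (c + 1 + d) = 0 ∧
    signedSum (digitSign x) 1 (c + 1 + d) = (c + 1) / 2 ∧
    signedSum (digitSign x) 2 (c + 1 + d) = 5 / 2 - (3 * c / 4 + 2) * (1 / 2) ^ c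
        + (c + 1) / 2 * (signTail x (c + 1) - signTail x (c + 1 + d)) ∧
    signedSum (digitSign x) 3 (c + 1 + d) =
      43 / 18 - 15 / 4 * (1 / 2) ^ c + (7 * c / 12 + 67 / 36) * ((1 / 2) ^ c) ^ 2
        + (5 / 2 - (3 * c / 4 + 2) * (1 / 2) ^ c + (c + 1) / 2 * signTail x (c + 1))
          * (signTail x (c + 1) - signTail x (c + 1 + d))
        - (c + 1) / 4 * (signTail x (c + 1) ^ 2 - signTail x (c + 1 + d) ^ 2
          + ((1 / 2) ^ (c + 1)) ^ 2 / 3 - ((1 / 2) ^ (c + 1 + d)) ^ 2 / 3) := by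
  induction d with
  | zero =>
    have hone : ∀ m < c, digitSign x m = 1 := fun m hm => by
      refine digitSign_eq_one hx ?_
      have hle : x * 2 ^ (m + 1) ≤ x * 2 ^ c := by gcongr <;> [norm_num; exact hm]
      rw [pow_succ] at h2
      linarith
    obtain ⟨e0, e1, e2, e3⟩ := signedSum_of_eq_one hone
    have hp : (1 / 2 : ℝ) ^ c * 2 ^ c = 1 := by rw [← mul_pow]; norm_num
    rw [add_zero, signedSum_zero_succ, signedSum_succ_succ, signedSum_succ_succ,
      signedSum_succ_succ, e0, e1, e2, e3, digitSign_eq_neg_one h1 h2]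
    refine ⟨by ring, ?_, by ring, by ring⟩
    linear_combination (-1 / 2) * hp
  | succ d ih =>
    obtain ⟨e0, e1, e2, e3⟩ := ih
    have hu := signTail_sub_succ hx (c + 1 + d)
    have hs : ((1 / 2) ^ (c + 1 + d + 1) * digitSign x (c + 1 + d)) ^ 2 =
        ((1 / 2 : ℝ) ^ (c + 1 + d + 1)) ^ 2 := by
      rw [mul_pow, ← sq_abs (digitSign x _), abs_digitSign, one_pow, mul_one]
    rw [← hu, pow_succ] at hs
    rw [← add_assoc, signedSum_zero_succ, signedSum_succ_succ, signedSum_succ_succ,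
      signedSum_succ_succ, e0, e1, e2, e3, ← hu]
    refine ⟨by ring, by ring, by ring, ?_⟩
    rw [pow_succ (1 / 2 : ℝ) (c + 1 + d)]
    linear_combination (-(c + 1) / 4 : ℝ) * hs

lemma exists_a1Int_eq {x : ℝ} (hx0 : 0 < x) (hx1 : x < 1) :
    ∃ c : ℕ, a1Int x = c + 1 ∧ 1 ≤ x * 2 ^ (c + 1) ∧ x * 2 ^ (c + 1) < 2 := by
  have hneg : ⌊Real.logb 2 x⌋ < 0 := by
    rw [Int.floor_lt]
    exact_mod_cast Real.logb_neg one_lt_two hx0 hx1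
  obtain ⟨c, hc⟩ := Int.eq_ofNat_of_zero_le (show 0 ≤ -⌊Real.logb 2 x⌋ - 1 by omega)
  have hfl : ⌊Real.logb 2 x⌋ = -((c + 1 : ℕ) : ℤ) := by push_cast; omega
  refine ⟨c, by rw [a1Int, if_neg hx0.ne']; omega, ?_, ?_⟩
  · have h := Int.floor_le (Real.logb 2 x)
    rw [hfl, Real.le_logb_iff_rpow_le one_lt_two hx0, Real.rpow_intCast, zpow_neg, zpow_natCast,
      inv_le_iff_one_le_mul₀ (by positivity)] at h
    exact h
  · have h := Int.lt_floor_add_one (Real.logb 2 x)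
    rw [hfl, Real.logb_lt_iff_lt_rpow one_lt_two hx0, Real.rpow_add two_pos, Real.rpow_one,
      Real.rpow_intCast, zpow_neg, zpow_natCast, inv_mul_eq_div, lt_div_iff₀ (by positivity)] at h
    exact h

lemma tendsto_signedSum_zero :
    Filter.Tendsto (signedSum (digitSign 0) 3) Filter.atTop (nhds (43 / 18)) := by
  have hq := tendsto_half_pow
  have hn : Filter.Tendsto (fun n : ℕ => (n : ℝ) * (1 / 2) ^ n) Filter.atTop (nhds 0) :=
    tendsto_self_mul_const_pow_of_lt_one (by norm_num) (by norm_num)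
  have h := ((hq.const_mul (5 / 2)).const_sub (43 / 18)).add
    (((hn.mul hq).const_mul (1 / 3)).add ((hq.pow 2).const_mul (10 / 9)))
  norm_num only at h
  refine h.congr fun n => ?_
  rw [(signedSum_of_eq_one fun m _ => digitSign_eq_one le_rfl (by simp)).2.2.2]
  ring

/-- In base `b = 2`, for every `x ∈ [0,1)`:
`ω_3(x) = (1 - 2x) + (1/3 - 2(1-x)x) + (1 - 43t_2)/18 + (5t_1 - 1)x - (2 - a_1)x²`. -/
theorem stmt13 (x : ℝ) (hx0 : 0 ≤ x) (hx1 : x < 1) :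
    omegaF 2 3 x =
      (((1 - 2 * x) + (1 / 3 - 2 * (1 - x) * x) + (1 - 43 * t2R x) / 18 +
        (5 * t1R x - 1) * x - (2 - (a1Int x : ℝ)) * x ^ 2 : ℝ) : ℂ) := by
  rcases hx0.eq_or_lt with rfl | hx
  · rw [omegaF_two_three_eq_of_tendsto tendsto_signedSum_zero]
    simp only [a1Int, t1R, t2R, if_true]
    norm_num
  obtain ⟨c, ha, h1, h2⟩ := exists_a1Int_eq hx hx1
  have ht1 : t1R x = (1 / 2) ^ (c + 1) := by
    rw [t1R, if_neg hx.ne', ha, zpow_neg, one_div, inv_pow]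
    norm_cast
  have ht2 : t2R x = ((1 / 2) ^ (c + 1)) ^ 2 := by
    rw [← ht1, t1R, t2R, if_neg hx.ne', if_neg hx.ne', ← zpow_natCast, ← zpow_mul]
    congr 1
    push_cast
    ring
  have hfr : Int.fract (x * 2 ^ (c + 1)) = x * 2 ^ (c + 1) - 1 := by
    rw [Int.fract_eq_iff]
    exact ⟨by linarith, by linarith, 1, by push_cast; ring⟩
  have hp : (1 / 2 : ℝ) ^ (c + 1) * 2 ^ (c + 1) = 1 := by rw [← mul_pow]; norm_num
  have hu : signTail x (c + 1) = 3 * (1 / 2) ^ (c + 1) - 2 * x := by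
    rw [signTail, hfr]
    linear_combination (-2 * x) * hp
  have hshift : Filter.Tendsto (fun d => c + 1 + d) Filter.atTop Filter.atTop :=
    Filter.tendsto_atTop_mono (fun d => Nat.le_add_left d (c + 1)) Filter.tendsto_id
  have hT := (tendsto_signTail x).comp hshift
  have hq := tendsto_half_pow.comp hshift
  have hlim := ((hT.const_sub (signTail x (c + 1))).const_mul
    (5 / 2 - (3 * c / 4 + 2) * (1 / 2) ^ c + (c + 1) / 2 * signTail x (c + 1))).const_add
      (43 / 18 - 15 / 4 * (1 / 2) ^ c + (7 * (c : ℝ) / 12 + 67 / 36) * ((1 / 2) ^ c) ^ 2) |>.sub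
    (((((hT.pow 2).const_sub (signTail x (c + 1) ^ 2)).add_const
      (((1 / 2 : ℝ) ^ (c + 1)) ^ 2 / 3)).sub ((hq.pow 2).div_const 3)).const_mul
        (((c : ℝ) + 1) / 4))
  have hS := hlim.congr fun d =>
    (signedSum_of_first_digit hx0 h1 h2 d).2.2.2.symm
  rw [omegaF_two_three_eq_of_tendsto ((Filter.tendsto_add_atTop_iff_nat (c + 1)).1
    (hS.congr fun d => by rw [add_comm])), hu, ht1, ht2, ha]
  congr 1
  push_cast
  ring
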